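/- Khintchine's theorem (inhomogeneous, 1-dimensional): there exists an absolute constant γ > 0 such that for every real θ there exists a real η with inf_{q ∈ ℕ} q · ‖qθ − η‖ > γ. -/

import Mathlib

/-- Distance from a real number to the nearest integer. -/
noncomputable def distNearestInt (t : ℝ) : ℝ := |t - round t|

theorem distNearestInt_le (t : ℝ) (z : ℤ) : distNearestInt t ≤ |t - z| := round_le t z

/-- Among the first and the last quarter of an interval of length `l`, at least one stays away from
the integers after multiplication by `m`, as long as `m * l` has moderate size. -/
theorem exists_quarter_distNearestInt_mul_ge {m l : ℝ} (hm : 0 < m) (hl : 0 < l)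
    (h₁ : 1 / 8 ≤ m * l) (h₂ : m * l ≤ 1 / 2) (x : ℝ) :
    ∃ x', x ≤ x' ∧ x' + l / 4 ≤ x + l ∧
      ∀ y ∈ Set.Icc x' (x' + l / 4), 1 / 32 ≤ distNearestInt (m * y) := by
  by_contra! H
  obtain ⟨u, ⟨hu₁, hu₂⟩, hu⟩ := H x le_rfl (by linarith)
  obtain ⟨v, ⟨hv₁, hv₂⟩, hv⟩ := H (x + 3 / 4 * l) (by linarith) (by linarith)
  unfold distNearestInt at hu hv
  rw [abs_lt] at hu hv
  have hlow : m * (l / 2) ≤ m * (v - u) := by gcongr; linarith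
  have hup : m * (v - u) ≤ m * l := by gcongr; linarith
  have hpos : (0 : ℝ) < ((round (m * v) - round (m * u) : ℤ) : ℝ) := by
    push_cast; linarith
  have hlt : ((round (m * v) - round (m * u) : ℤ) : ℝ) < 1 := by
    push_cast; linarith
  have hpos' : 0 < round (m * v) - round (m * u) := by exact_mod_cast hpos
  have hlt' : round (m * v) - round (m * u) < 1 := by exact_mod_cast hlt
  omega

/-- For integers `m j ∈ [4 ^ j, 4 ^ (j + 1))` some `η` has all multiples `m j * η` uniformly away
from the integers. -/
theorem exists_forall_distNearestInt_mul_ge (m : ℕ → ℕ)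
    (hm : ∀ j, 4 ^ j ≤ m j ∧ m j < 4 ^ (j + 1)) :
    ∃ η : ℝ, ∀ j, 1 / 32 ≤ distNearestInt (m j * η) := by
  let l : ℕ → ℝ := fun j ↦ 1 / 8 / 4 ^ j
  have hl : ∀ j, 0 < l j := fun j ↦ by positivity
  have hl_succ : ∀ j, l (j + 1) = l j / 4 := fun j ↦ by simp only [l, pow_succ]; field_simp
  have step : ∀ j (x : ℝ), ∃ x', x ≤ x' ∧ x' + l j / 4 ≤ x + l j ∧
      ∀ y ∈ Set.Icc x' (x' + l j / 4), 1 / 32 ≤ distNearestInt (m j * y) := by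
    intro j x
    have hlow : (4 : ℝ) ^ j ≤ m j := by exact_mod_cast (hm j).1
    have hup : (m j : ℝ) ≤ 4 ^ j * 4 := by
      rw [← pow_succ]; exact_mod_cast (hm j).2.le
    have h4 : (0 : ℝ) < 4 ^ j := by positivity
    have hmul : (4 : ℝ) ^ j * l j = 1 / 8 := by simp only [l]; field_simp
    refine exists_quarter_distNearestInt_mul_ge (h4.trans_le hlow) (hl j) ?_ ?_ x
    · linarith [mul_le_mul_of_nonneg_right hlow (hl j).le]
    · linarith [mul_le_mul_of_nonneg_right hup (hl j).le]
  choose next hnext using step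
  let x : ℕ → ℝ := fun j ↦ Nat.rec 0 next j
  have hx : ∀ j, x (j + 1) = next j (x j) := fun _ ↦ rfl
  have hmono : Monotone x := monotone_nat_of_le_succ fun j ↦ hx j ▸ (hnext j (x j)).1
  have hanti : Antitone fun j ↦ x j + l j := antitone_nat_of_succ_le fun j ↦ by
    rw [hl_succ, hx]; exact (hnext j (x j)).2.1
  have hmem := hmono.ciSup_mem_iInter_Icc_of_antitone hanti
    fun j ↦ le_add_of_nonneg_right (hl j).le
  refine ⟨⨆ j, x j, fun j ↦ (hnext j (x j)).2.2 _ ?_⟩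
  rw [← hx, ← hl_succ]
  exact Set.mem_iInter.1 hmem (j + 1)

theorem distNearestInt_mul_le (m q : ℕ) (θ η : ℝ) :
    distNearestInt (m * η) ≤
      m * distNearestInt (q * θ - η) + q * distNearestInt (m * θ) := by
  refine (distNearestInt_le _ (q * round (m * θ) - m * round (q * θ - η))).trans ?_
  unfold distNearestInt
  calc _ = |(-(m * (q * θ - η - round (q * θ - η)))) + q * (m * θ - round (m * θ))| := by
        push_cast; ring_nf
    _ ≤ _ := by
        refine (abs_add_le _ _).trans_eq ?_
        simp only [abs_neg, abs_mul, Nat.abs_cast]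

theorem stmt14 : ∃ γ : ℝ, 0 < γ ∧ ∀ θ : ℝ, ∃ η : ℝ,
    γ < ⨅ q : ℕ+, (q : ℝ) * distNearestInt (q * θ - η) := by
  refine ⟨1 / 20000, by norm_num, fun θ ↦ ?_⟩
  have hmin : ∀ j : ℕ, ∃ m ∈ Finset.Ico (4 ^ j) (4 ^ (j + 1)), ∀ n ∈ Finset.Ico (4 ^ j) (4 ^ (j + 1)),
      distNearestInt ((m : ℕ) * θ) ≤ distNearestInt ((n : ℕ) * θ) := fun j ↦
    Finset.exists_min_image _ (fun n : ℕ ↦ distNearestInt (n * θ))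
      (Finset.nonempty_Ico.2 (Nat.pow_lt_pow_right (by norm_num) j.lt_succ_self))
  choose m hm hm_min using hmin
  simp only [Finset.mem_Ico] at hm hm_min
  obtain ⟨η, hη⟩ := exists_forall_distNearestInt_mul_ge m hm
  refine ⟨η, lt_of_lt_of_le (b := 1 / 16384) (by norm_num) (le_ciInf fun q ↦ ?_)⟩
  have hq : (0 : ℝ) < (q : ℕ) := by exact_mod_cast q.pos
  obtain ⟨n, hn_pos, hn_le, hn⟩ :=
    Real.exists_nat_abs_mul_sub_round_le θ (n := 64 * q) (by positivity)
  have hlow : 4 ^ Nat.log 4 n ≤ n := Nat.pow_log_le_self 4 hn_pos.ne'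
  have hup : n < 4 ^ (Nat.log 4 n + 1) := Nat.lt_pow_succ_log_self (by norm_num) n
  set j := Nat.log 4 n
  have hmθ : distNearestInt (m j * θ) ≤ 1 / (64 * (q : ℕ)) := by
    refine ((hm_min j n ⟨hlow, hup⟩).trans hn).trans ?_
    push_cast
    exact one_div_le_one_div_of_le (by positivity) (by linarith)
  have hm_le : (m j : ℝ) ≤ 256 * (q : ℕ) := by
    have := (hm j).2
    rw [pow_succ] at this
    exact_mod_cast (by omega : m j ≤ 256 * (q : ℕ))
  have hqm : (q : ℕ) * distNearestInt (m j * θ) ≤ 1 / 64 := by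
    refine (mul_le_mul_of_nonneg_left hmθ hq.le).trans_eq ?_
    field_simp
  have hmq := mul_le_mul_of_nonneg_right hm_le
    (show 0 ≤ distNearestInt ((q : ℕ) * θ - η) from abs_nonneg _)
  linarith [hη j, distNearestInt_mul_le (m j) q θ η]
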